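/- Assume n ≥ 2. For every σ ∈ ℝ, the assignment γ_i^{±1} ↦ C_i^{±1} + I (1 ≤ i ≤ 2n), β_j ↦ B_j + I (j ∈ {1,…,2n−1}, j ≠ n), β_n ↦ B̂_n^σ + I extends (necessarily uniquely) to an algebra homomorphism φ_σ : 𝒜 → U_q(k)/I. -/

import Mathlib

namespace QG

/-- Generators of the quantized universal enveloping algebra `U_q(gl(m))`:
`K i`, its inverse `Ki i`, and the Chevalley generators `E j` (the `x_j`)
and `F j` (the `y_j`).  Indices are 1-based natural numbers; out-of-range
generators are forced to be `1` (resp. `0`) by the relations. -/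
inductive Gen : Type where
  | K : ℕ → Gen
  | Ki : ℕ → Gen
  | E : ℕ → Gen
  | F : ℕ → Gen

abbrev FA := FreeAlgebra ℂ Gen

noncomputable def fK (i : ℕ) : FA := FreeAlgebra.ι ℂ (Gen.K i)
noncomputable def fKi (i : ℕ) : FA := FreeAlgebra.ι ℂ (Gen.Ki i)
noncomputable def fE (i : ℕ) : FA := FreeAlgebra.ι ℂ (Gen.E i)
noncomputable def fF (i : ℕ) : FA := FreeAlgebra.ι ℂ (Gen.F i)

/-- Kronecker delta with values in `ℤ`. -/
def kd (i j : ℕ) : ℤ := if i = j then 1 else 0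

/-- The defining relations of `U_q(gl(m))`. -/
inductive Rel (q : ℝ) (m : ℕ) : FA → FA → Prop
  | Kout : ∀ i, ¬(1 ≤ i ∧ i ≤ m) → Rel q m (fK i) 1
  | Kiout : ∀ i, ¬(1 ≤ i ∧ i ≤ m) → Rel q m (fKi i) 1
  | Eout : ∀ j, ¬(1 ≤ j ∧ j + 1 ≤ m) → Rel q m (fE j) 0
  | Fout : ∀ j, ¬(1 ≤ j ∧ j + 1 ≤ m) → Rel q m (fF j) 0
  | KK : ∀ i j, Rel q m (fK i * fK j) (fK j * fK i)
  | KKi : ∀ i, Rel q m (fK i * fKi i) 1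
  | KiK : ∀ i, Rel q m (fKi i * fK i) 1
  | KE : ∀ i j, 1 ≤ i → i ≤ m → 1 ≤ j → j + 1 ≤ m →
      Rel q m (fK i * fE j) (((q : ℂ) ^ (kd i j - kd i (j+1))) • (fE j * fK i))
  | KF : ∀ i j, 1 ≤ i → i ≤ m → 1 ≤ j → j + 1 ≤ m →
      Rel q m (fK i * fF j) (((q : ℂ) ^ (kd i (j+1) - kd i j)) • (fF j * fK i))
  | EF : ∀ i j, 1 ≤ i → i + 1 ≤ m → 1 ≤ j → j + 1 ≤ m →
      Rel q m (fE i * fF j - fF j * fE i)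
        (if i = j then ((q : ℂ) - (q : ℂ)⁻¹)⁻¹ • (fK i * fKi (i+1) - fKi i * fK (i+1)) else 0)
  | EE : ∀ i j, 1 ≤ i → i + 1 ≤ m → 1 ≤ j → j + 1 ≤ m → (i + 2 ≤ j ∨ j + 2 ≤ i) →
      Rel q m (fE i * fE j) (fE j * fE i)
  | FF : ∀ i j, 1 ≤ i → i + 1 ≤ m → 1 ≤ j → j + 1 ≤ m → (i + 2 ≤ j ∨ j + 2 ≤ i) →
      Rel q m (fF i * fF j) (fF j * fF i)
  | Eserre : ∀ i j, 1 ≤ i → i + 1 ≤ m → 1 ≤ j → j + 1 ≤ m → (i + 1 = j ∨ j + 1 = i) →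
      Rel q m (fE i ^ 2 * fE j - ((q : ℂ) + (q : ℂ)⁻¹) • (fE i * fE j * fE i) + fE j * fE i ^ 2) 0
  | Fserre : ∀ i j, 1 ≤ i → i + 1 ≤ m → 1 ≤ j → j + 1 ≤ m → (i + 1 = j ∨ j + 1 = i) →
      Rel q m (fF i ^ 2 * fF j - ((q : ℂ) + (q : ℂ)⁻¹) • (fF i * fF j * fF i) + fF j * fF i ^ 2) 0

/-- The quantized universal enveloping algebra `U_q(gl(m))`. -/
abbrev Uq (q : ℝ) (m : ℕ) := RingQuot (Rel q m)

noncomputable def uK (q : ℝ) (m i : ℕ) : Uq q m := RingQuot.mkAlgHom ℂ (Rel q m) (fK i)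
noncomputable def uKi (q : ℝ) (m i : ℕ) : Uq q m := RingQuot.mkAlgHom ℂ (Rel q m) (fKi i)
noncomputable def uE (q : ℝ) (m i : ℕ) : Uq q m := RingQuot.mkAlgHom ℂ (Rel q m) (fE i)
noncomputable def uF (q : ℝ) (m i : ℕ) : Uq q m := RingQuot.mkAlgHom ℂ (Rel q m) (fF i)

/-- `C_i = K_i K_{2n+1-i}` in `U_q(gl(2n))`. -/
noncomputable def Cc (q : ℝ) (n i : ℕ) : Uq q (2*n) := uK q (2*n) i * uK q (2*n) (2*n+1-i)
/-- `C_i⁻¹ = K_i⁻¹ K_{2n+1-i}⁻¹` in `U_q(gl(2n))`. -/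
noncomputable def Ccinv (q : ℝ) (n i : ℕ) : Uq q (2*n) := uKi q (2*n) i * uKi q (2*n) (2*n+1-i)
/-- `B_j = y_j K_{j+1}⁻¹ K_{2n-j}⁻¹ + K_j⁻¹ x_{2n-j} K_{2n-j}⁻¹` in `U_q(gl(2n))`. -/
noncomputable def Bb (q : ℝ) (n j : ℕ) : Uq q (2*n) :=
  uF q (2*n) j * uKi q (2*n) (j+1) * uKi q (2*n) (2*n-j)
  + uKi q (2*n) j * uE q (2*n) (2*n-j) * uKi q (2*n) (2*n-j)
/-- `B_n^σ = y_n K_{n+1}⁻¹ K_n⁻¹ + K_n⁻¹ x_n K_n⁻¹ + ((q^{-σ}-q^{σ})/(q-q⁻¹)) K_n⁻²`. -/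
noncomputable def Bs (q σ : ℝ) (n : ℕ) : Uq q (2*n) :=
  uF q (2*n) n * uKi q (2*n) (n+1) * uKi q (2*n) n
  + uKi q (2*n) n * uE q (2*n) n * uKi q (2*n) n
  + (((q ^ (-σ) - q ^ σ) / (q - q⁻¹) : ℝ) : ℂ) • ((uKi q (2*n) n)^2)

/-- The generating set of the coideal subalgebra `𝒜_σ ⊆ U_q(gl(2n))`. -/
def ASet (q σ : ℝ) (n : ℕ) : Set (Uq q (2*n)) :=
  {z | (∃ i, 1 ≤ i ∧ i ≤ 2*n ∧ (z = Cc q n i ∨ z = Ccinv q n i)) ∨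
       (∃ j, 1 ≤ j ∧ j + 1 ≤ 2*n ∧ j ≠ n ∧ z = Bb q n j) ∨ z = Bs q σ n}

/-- Generators of the abstract algebra `𝒜`. -/
inductive AGen : Type where
  | g : ℕ → AGen
  | gi : ℕ → AGen
  | b : ℕ → AGen

abbrev AFA := FreeAlgebra ℂ AGen

noncomputable def fγ (i : ℕ) : AFA := FreeAlgebra.ι ℂ (AGen.g i)
noncomputable def fγi (i : ℕ) : AFA := FreeAlgebra.ι ℂ (AGen.gi i)
noncomputable def fβ (j : ℕ) : AFA := FreeAlgebra.ι ℂ (AGen.b j)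

/-- `(ε_i + ε_{2n+1-i}, α_j)` where `α_j = ε_j - ε_{j+1}`. -/
def gex (n i j : ℕ) : ℤ := kd i j + kd (2*n+1-i) j - kd i (j+1) - kd (2*n+1-i) (j+1)

/-- The defining relations of the algebra `𝒜`. -/
inductive ARel (q : ℝ) (n : ℕ) : AFA → AFA → Prop
  | gout : ∀ i, ¬(1 ≤ i ∧ i ≤ 2*n) → ARel q n (fγ i) 1
  | giout : ∀ i, ¬(1 ≤ i ∧ i ≤ 2*n) → ARel q n (fγi i) 1
  | bout : ∀ j, ¬(1 ≤ j ∧ j + 1 ≤ 2*n) → ARel q n (fβ j) 0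
  | gg : ∀ i j, ARel q n (fγ i * fγ j) (fγ j * fγ i)
  | ggi : ∀ i, ARel q n (fγ i * fγi i) 1
  | gig : ∀ i, ARel q n (fγi i * fγ i) 1
  | gsym : ∀ i, 1 ≤ i → i ≤ 2*n → ARel q n (fγ i) (fγ (2*n+1-i))
  | gb : ∀ i j, 1 ≤ i → i ≤ 2*n → 1 ≤ j → j + 1 ≤ 2*n →
      ARel q n (fγ i * fβ j) (((q : ℂ) ^ (-(gex n i j))) • (fβ j * fγ i))
  | bb : ∀ i j, 1 ≤ i → i + 1 ≤ 2*n → 1 ≤ j → j + 1 ≤ 2*n → (i + 2 ≤ j ∨ j + 2 ≤ i) →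
      ARel q n (fβ i * fβ j - fβ j * fβ i)
        (if i + j = 2*n then ((q : ℂ) * ((q : ℂ) - (q : ℂ)⁻¹)⁻¹) • (fγi i ^ 2 - fγi (i+1) ^ 2)
         else 0)
  | serre1 : ∀ i, 1 ≤ i → i + 2 ≤ 2*n →
      ARel q n
        ((q : ℂ)⁻¹ • (fβ i ^ 2 * fβ (i+1)) - ((q : ℂ) + (q : ℂ)⁻¹) • (fβ i * fβ (i+1) * fβ i)
          + (q : ℂ) • (fβ (i+1) * fβ i ^ 2))
        (if i = n then (q : ℂ) • (fβ (n+1) * fγi n ^ 2) else 0)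
  | serre2 : ∀ i, 2 ≤ i → i + 1 ≤ 2*n →
      ARel q n
        ((q : ℂ) • (fβ i ^ 2 * fβ (i-1)) - ((q : ℂ) + (q : ℂ)⁻¹) • (fβ i * fβ (i-1) * fβ i)
          + (q : ℂ)⁻¹ • (fβ (i-1) * fβ i ^ 2))
        (if i = n then (q : ℂ)⁻¹ • (fβ (n-1) * fγi n ^ 2) else 0)

/-- The abstract algebra `𝒜`. -/
abbrev Aalg (q : ℝ) (n : ℕ) := RingQuot (ARel q n)

noncomputable def aγ (q : ℝ) (n i : ℕ) : Aalg q n := RingQuot.mkAlgHom ℂ (ARel q n) (fγ i)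
noncomputable def aγi (q : ℝ) (n i : ℕ) : Aalg q n := RingQuot.mkAlgHom ℂ (ARel q n) (fγi i)
noncomputable def aβ (q : ℝ) (n j : ℕ) : Aalg q n := RingQuot.mkAlgHom ℂ (ARel q n) (fβ j)

end QG

namespace QG

/-- The generating set of the subalgebra `U_q(k) ⊆ U_q(gl(2n))`: the `K_i^{±1}`
(`1 ≤ i ≤ 2n`) and the `x_j, y_j` (`j ∈ {1,…,2n−1}`, `j ≠ n`). -/
def KSet (q : ℝ) (n : ℕ) : Set (Uq q (2*n)) :=
  {z | (∃ i, 1 ≤ i ∧ i ≤ 2*n ∧ (z = uK q (2*n) i ∨ z = uKi q (2*n) i)) ∨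
       (∃ j, 1 ≤ j ∧ j + 1 ≤ 2*n ∧ j ≠ n ∧ (z = uE q (2*n) j ∨ z = uF q (2*n) j))}

/-- The subalgebra `U_q(k)`. -/
noncomputable def UkSub (q : ℝ) (n : ℕ) : Subalgebra ℂ (Uq q (2*n)) :=
  Algebra.adjoin ℂ (KSet q n)

/-- The relation on `U_q(k)` killing `x_{n−1} y_{n+1}` and `x_{n+1} y_{n−1}`;
the corresponding `RingQuot` is the quotient of `U_q(k)` by the two-sided ideal `I`
generated by these elements. -/
def IRel (q : ℝ) (n : ℕ) : ↥(UkSub q n) → ↥(UkSub q n) → Prop := fun a b =>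
  b = 0 ∧ ((a : Uq q (2*n)) = uE q (2*n) (n-1) * uF q (2*n) (n+1) ∨
           (a : Uq q (2*n)) = uE q (2*n) (n+1) * uF q (2*n) (n-1))

/-- The quotient algebra `U_q(k)/I`. -/
abbrev UkQ (q : ℝ) (n : ℕ) := RingQuot (IRel q n)

/-- The quotient map `U_q(k) → U_q(k)/I`. -/
noncomputable def ukmk (q : ℝ) (n : ℕ) : ↥(UkSub q n) →ₐ[ℂ] UkQ q n :=
  RingQuot.mkAlgHom ℂ (IRel q n)

/-- `B̂_n^σ = (q^{-σ} K_{n+1}⁻² - q^{σ} K_n⁻²)/(q - q⁻¹)` in `U_q(gl(2n))`. -/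
noncomputable def Bhat (q σ : ℝ) (n : ℕ) : Uq q (2*n) :=
  ((q : ℂ) - (q : ℂ)⁻¹)⁻¹ •
    (((q ^ (-σ) : ℝ) : ℂ) • ((uKi q (2*n) (n+1))^2) - ((q ^ σ : ℝ) : ℂ) • ((uKi q (2*n) n)^2))

end QG

namespace QG

section RingIdentities

variable {A : Type*} [Ring A]

theorem mul_left_swap {x y : A} (h : x * y = y * x) (z : A) :
    x * (y * z) = y * (x * z) := by
  rw [← mul_assoc, h, mul_assoc]

theorem torus_cancel {a b c d m : A} (hab : a * b = 1) (hcd : c * d = 1) (had : a * d = d * a)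
    (hbd : b * d = d * b) (hbm : b * m = m * b) :
    (a * d - b * c) * (d * m * (m * b)) = (d ^ 2 - b ^ 2) * m ^ 2 := by
  have h₁ : d * m * (m * b) = b * (d * m ^ 2) := by
    simp only [pow_two, mul_assoc, hbm, mul_left_swap hbd, mul_left_swap hbm]
  have h₂ : a * d * (b * (d * m ^ 2)) = d ^ 2 * m ^ 2 := by
    rw [had, mul_assoc, ← mul_assoc a b, hab, one_mul, ← mul_assoc, pow_two d]
  have h₃ : b * c * (b * (d * m ^ 2)) = b ^ 2 * m ^ 2 := by
    rw [mul_left_swap hbd, mul_assoc, ← mul_assoc c d, hcd, one_mul, ← mul_assoc, pow_two b]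
  rw [h₁, sub_mul, h₂, h₃, sub_mul]

end RingIdentities

section QuantumIdentities

variable {A : Type*} [Ring A] [Algebra ℂ A]

/-- The deformed quantum Serre polynomial
`p⁻¹ a² b - (p + p⁻¹) a b a + p b a²`. -/
noncomputable def qSerre (p : ℂ) (a b : A) : A :=
  p⁻¹ • (a ^ 2 * b) - (p + p⁻¹) • (a * b * a) + p • (b * a ^ 2)

theorem qSerre_add_right (p : ℂ) (a b c : A) :
    qSerre p a (b + c) = qSerre p a b + qSerre p a c := by
  simp only [qSerre, mul_add, add_mul]
  module

theorem qSerre_smul_right (p r : ℂ) (a b : A) :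
    qSerre p a (r • b) = r • qSerre p a b := by
  simp only [qSerre, mul_smul_comm, smul_mul_assoc]
  module

theorem mul_left_rule {x y : A} {c : ℂ} (h : x * y = c • (y * x)) (z : A) :
    x * (y * z) = c • (y * (x * z)) := by
  rw [← mul_assoc, h, smul_mul_assoc, mul_assoc]

/-- Two products `x T` and `y S` of commuting elements with quasi-commuting
torus factors quasi-commute. -/
theorem mul_mul_swap {x y S T : A} {c d : ℂ} (hd : d ≠ 0) (hxy : x * y = y * x)
    (hT : T * y = c • (y * T)) (hS : S * x = d • (x * S)) (hTS : T * S = S * T) :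
    x * T * (y * S) = (c * d⁻¹) • (y * S * (x * T)) := by
  simp only [mul_assoc, mul_left_rule hT, mul_left_rule hS, mul_smul_comm, smul_smul,
    mul_left_swap hxy, hTS]
  rw [inv_mul_cancel₀ hd, mul_one]

theorem qSerre_eq_zero_of_qcomm {p c : ℂ} {a b : A} (h : b * a = c • (a * b))
    (hc : p⁻¹ - (p + p⁻¹) * c + p * c ^ 2 = 0) : qSerre p a b = 0 := by
  have key : qSerre p a b = (p⁻¹ - (p + p⁻¹) * c + p * c ^ 2) • (a * (a * b)) := by
    simp only [qSerre, pow_two, mul_assoc, h, mul_left_rule h, mul_smul_comm, smul_smul]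
    module
  rw [key, hc, zero_smul]

/-- The quantum Serre relation for `x`, `y` gives the deformed one for `x T`, `y S`. -/
theorem qSerre_mul_torus {p c d : ℂ} (hp : p ≠ 0) {x y S T : A}
    (hTx : T * x = c • (x * T)) (hTy : T * y = (p * d) • (y * T)) (hSx : S * x = d • (x * S))
    (hTS : T * S = S * T)
    (hxy : x ^ 2 * y - (p + p⁻¹) • (x * y * x) + y * x ^ 2 = 0) :
    qSerre p (x * T) (y * S) = 0 := by
  have key : qSerre p (x * T) (y * S) =
      (p * c * d ^ 2) •
        ((x ^ 2 * y - (p + p⁻¹) • (x * y * x) + y * x ^ 2) * (T * (T * S))) := by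
    simp only [qSerre, pow_two, mul_assoc, mul_left_rule hTx, mul_left_rule hTy,
      mul_left_rule hSx, hTS, mul_left_swap hTS, mul_smul_comm,
      smul_smul, sub_mul, add_mul, smul_mul_assoc]
    match_scalars <;> field_simp
  rw [key, hxy, zero_mul, smul_zero]

theorem qSerre_add_add {p : ℂ} (hp : p ≠ 0) {x y x' y' : A}
    (hx : qSerre p x x' = 0) (hy : qSerre p y y' = 0)
    (hyx : y * x = (p ^ 2) • (x * y)) (hxy' : x * y' = (p ^ 2) • (y' * x))
    (hyx' : y * x' = x' * y) : qSerre p (x + y) (x' + y') = 0 := by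
  have hxy : x * y = (p⁻¹ ^ 2) • (y * x) := by
    rw [hyx, smul_smul]
    field_simp
    simp
  have h₁ : qSerre p x y' = 0 := by
    refine qSerre_eq_zero_of_qcomm (c := p⁻¹ ^ 2) ?_ (by field_simp; ring)
    rw [hxy', smul_smul]
    field_simp
    simp
  have h₂ : qSerre p y x' = 0 :=
    qSerre_eq_zero_of_qcomm (c := 1) (by rw [hyx', one_smul]) (by field_simp; ring)
  have h₃ : p⁻¹ • ((x * y + y * x) * x') - (p + p⁻¹) • (x * x' * y + y * x' * x)
      + p • (x' * (x * y + y * x)) = 0 := by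
    have e₁ : x * y * x' = x * x' * y := by rw [mul_assoc, hyx', mul_assoc]
    have e₂ : y * x * x' = (p ^ 2) • (x * x' * y) := by rw [hyx, smul_mul_assoc, e₁]
    have e₃ : x' * (y * x) = y * x' * x := by rw [← mul_assoc, hyx']
    have e₄ : x' * (x * y) = (p⁻¹ ^ 2) • (y * x' * x) := by rw [hxy, mul_smul_comm, e₃]
    simp only [add_mul, mul_add, e₁, e₂, e₃, e₄, smul_add, smul_smul]
    match_scalars <;> field_simp <;> ring
  have h₄ : p⁻¹ • ((x * y + y * x) * y') - (p + p⁻¹) • (x * y' * y + y * y' * x)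
      + p • (y' * (x * y + y * x)) = 0 := by
    have e₁ : y * x * y' = (p ^ 2) • (y * y' * x) := by
      rw [mul_assoc, hxy', mul_smul_comm, mul_assoc]
    have e₂ : x * y * y' = y * y' * x := by
      rw [hxy, smul_mul_assoc, e₁, smul_smul]
      field_simp
      simp
    have e₃ : x * y' * y = (p ^ 2) • (y' * (x * y)) := by
      rw [hxy', smul_mul_assoc, mul_assoc]
    have e₄ : y' * (y * x) = (p ^ 2) • (y' * (x * y)) := by rw [hyx, mul_smul_comm]
    simp only [add_mul, mul_add, e₁, e₂, e₃, e₄, smul_add, smul_smul]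
    match_scalars <;> field_simp <;> ring
  have expand : qSerre p (x + y) (x' + y') =
      qSerre p x x' + qSerre p y y' + qSerre p x y' + qSerre p y x' +
      (p⁻¹ • ((x * y + y * x) * x') - (p + p⁻¹) • (x * x' * y + y * x' * x)
        + p • (x' * (x * y + y * x))) +
      (p⁻¹ • ((x * y + y * x) * y') - (p + p⁻¹) • (x * y' * y + y * y' * x)
        + p • (y' * (x * y + y * x))) := by
    simp only [qSerre, pow_two, add_mul, mul_add, mul_assoc]
    module
  rw [expand, hx, hy, h₁, h₂, h₃, h₄]
  simp

theorem qSerre_add_of_mul_eq_zero {p c d : ℂ} {x y u : A}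
    (hxy : x * y = 0) (hyx : y * x = 0)
    (hx : u * x = c • (x * u)) (hy : u * y = d • (y * u))
    (hc : p⁻¹ - (p + p⁻¹) * c + p * c ^ 2 = 0)
    (hd : p⁻¹ - (p + p⁻¹) * d + p * d ^ 2 = 0) : qSerre p (x + y) u = 0 := by
  have hxuy : x * u * y = 0 := by
    rw [mul_assoc, hy, mul_smul_comm, ← mul_assoc, hxy, zero_mul, smul_zero]
  have hyux : y * u * x = 0 := by
    rw [mul_assoc, hx, mul_smul_comm, ← mul_assoc, hyx, zero_mul, smul_zero]
  have expand : qSerre p (x + y) u = qSerre p x u + qSerre p y u := by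
    simp only [qSerre, pow_two, add_mul, mul_add, hxy, hyx, hxuy, hyux]
    simp only [zero_mul, mul_zero]
    module
  rw [expand, qSerre_eq_zero_of_qcomm hx hc, qSerre_eq_zero_of_qcomm hy hd, add_zero]

/-- The inhomogeneous Serre relation satisfied by a combination of two torus elements. -/
theorem qSerre_torus {p r a b : ℂ} (hp : p ≠ 0) {x u v : A}
    (hu : u * x = (p ^ 2) • (x * u)) (hv : v * x = x * v) (huv : u * v = v * u)
    (hr : r ^ 2 * (p - p⁻¹) ^ 2 = 1) (hab : a * b = 1) :
    qSerre p (r • (a • u - b • v)) x = p • (x * (u * v)) := by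
  have key : qSerre p (r • (a • u - b • v)) x =
      (r ^ 2 * (p - p⁻¹) ^ 2 * (a * b)) • p • (x * (u * v)) := by
    simp only [qSerre, pow_two, smul_sub, smul_smul, sub_mul, mul_sub, smul_mul_assoc,
      mul_smul_comm, mul_assoc, hu, hv, mul_left_rule hu, mul_left_swap hv, huv.symm]
    match_scalars <;> field_simp <;> ring
  rw [key, hr, hab, mul_one, one_smul]

theorem inv_mul_qcomm {k l x : A} {c : ℂ} (hc : c ≠ 0) (hkl : k * l = 1) (hlk : l * k = 1)
    (h : k * x = c • (x * k)) : l * x = c⁻¹ • (x * l) := by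
  have h' : x * k = c⁻¹ • (k * x) := by rw [h, smul_smul, inv_mul_cancel₀ hc, one_smul]
  calc l * x = l * (x * k) * l := by rw [mul_assoc, mul_assoc, hkl, mul_one]
    _ = c⁻¹ • (x * l) := by
      rw [h', mul_smul_comm, ← mul_assoc, hlk, one_mul, smul_mul_assoc]

theorem inv_mul_comm {k l x : A} (hkl : k * l = 1) (hlk : l * k = 1)
    (h : k * x = x * k) : l * x = x * l := by
  simpa using inv_mul_qcomm (c := 1) one_ne_zero hkl hlk (by simpa using h)

end QuantumIdentities

/-- The exponent `(ε_i, α_j)` where `α_j = ε_j - ε_{j+1}`. -/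
def rootPairing (i j : ℕ) : ℤ := kd i j - kd i (j + 1)

/-- Elements of an algebra satisfying the relations of the generators of `U_q(k)`
(Levi subalgebra of `U_q(gl(2n))`), together with the vanishing of
`x_{n-1} y_{n+1}` and `x_{n+1} y_{n-1}`. -/
structure LeviSystem {A : Type*} [Ring A] [Algebra ℂ A] (q : ℂ) (n : ℕ)
    (k ki e f : ℕ → A) : Prop where
  k_out : ∀ i, ¬(1 ≤ i ∧ i ≤ 2 * n) → k i = 1
  ki_out : ∀ i, ¬(1 ≤ i ∧ i ≤ 2 * n) → ki i = 1
  e_out : ∀ j, ¬(1 ≤ j ∧ j + 1 ≤ 2 * n) → e j = 0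
  f_out : ∀ j, ¬(1 ≤ j ∧ j + 1 ≤ 2 * n) → f j = 0
  k_k : ∀ i j, k i * k j = k j * k i
  k_ki : ∀ i, k i * ki i = 1
  ki_k : ∀ i, ki i * k i = 1
  k_e : ∀ i j, 1 ≤ i → i ≤ 2 * n → 1 ≤ j → j + 1 ≤ 2 * n → j ≠ n →
    k i * e j = (q ^ rootPairing i j) • (e j * k i)
  k_f : ∀ i j, 1 ≤ i → i ≤ 2 * n → 1 ≤ j → j + 1 ≤ 2 * n → j ≠ n →
    k i * f j = (q ^ (-rootPairing i j)) • (f j * k i)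
  e_f : ∀ i, 1 ≤ i → i + 1 ≤ 2 * n → i ≠ n →
    e i * f i - f i * e i = (q - q⁻¹)⁻¹ • (k i * ki (i + 1) - ki i * k (i + 1))
  e_f_comm : ∀ i j, 1 ≤ i → i + 1 ≤ 2 * n → i ≠ n → 1 ≤ j → j + 1 ≤ 2 * n → j ≠ n →
    i ≠ j → e i * f j = f j * e i
  e_e : ∀ i j, 1 ≤ i → i + 1 ≤ 2 * n → i ≠ n → 1 ≤ j → j + 1 ≤ 2 * n → j ≠ n →
    (i + 2 ≤ j ∨ j + 2 ≤ i) → e i * e j = e j * e i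
  f_f : ∀ i j, 1 ≤ i → i + 1 ≤ 2 * n → i ≠ n → 1 ≤ j → j + 1 ≤ 2 * n → j ≠ n →
    (i + 2 ≤ j ∨ j + 2 ≤ i) → f i * f j = f j * f i
  e_serre : ∀ i j, 1 ≤ i → i + 1 ≤ 2 * n → i ≠ n → 1 ≤ j → j + 1 ≤ 2 * n → j ≠ n →
    (i + 1 = j ∨ j + 1 = i) →
    e i ^ 2 * e j - (q + q⁻¹) • (e i * e j * e i) + e j * e i ^ 2 = 0
  f_serre : ∀ i j, 1 ≤ i → i + 1 ≤ 2 * n → i ≠ n → 1 ≤ j → j + 1 ≤ 2 * n → j ≠ n →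
    (i + 1 = j ∨ j + 1 = i) →
    f i ^ 2 * f j - (q + q⁻¹) • (f i * f j * f i) + f j * f i ^ 2 = 0
  e_f_pred : e (n - 1) * f (n + 1) = 0
  e_f_succ : e (n + 1) * f (n - 1) = 0

namespace LeviSystem

variable {A : Type*} [Ring A] [Algebra ℂ A] {q : ℂ} {n : ℕ} {k ki e f : ℕ → A}

theorem ki_comm_k (h : LeviSystem q n k ki e f) (i j : ℕ) : ki i * k j = k j * ki i :=
  inv_mul_comm (h.k_ki i) (h.ki_k i) (h.k_k i j)

theorem ki_comm (h : LeviSystem q n k ki e f) (i j : ℕ) : ki i * ki j = ki j * ki i :=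
  (inv_mul_comm (h.k_ki j) (h.ki_k j) (h.ki_comm_k i j).symm).symm

theorem ki_e (h : LeviSystem q n k ki e f) (hq : q ≠ 0) {i j : ℕ} (hi : 1 ≤ i)
    (hi' : i ≤ 2 * n) (hj : 1 ≤ j) (hj' : j + 1 ≤ 2 * n) (hjn : j ≠ n) :
    ki i * e j = (q ^ (-rootPairing i j)) • (e j * ki i) := by
  rw [zpow_neg]
  exact inv_mul_qcomm (zpow_ne_zero _ hq) (h.k_ki i) (h.ki_k i) (h.k_e i j hi hi' hj hj' hjn)

theorem ki_f (h : LeviSystem q n k ki e f) (hq : q ≠ 0) {i j : ℕ} (hi : 1 ≤ i)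
    (hi' : i ≤ 2 * n) (hj : 1 ≤ j) (hj' : j + 1 ≤ 2 * n) (hjn : j ≠ n) :
    ki i * f j = (q ^ (rootPairing i j)) • (f j * ki i) := by
  have := inv_mul_qcomm (zpow_ne_zero _ hq) (h.k_ki i) (h.ki_k i) (h.k_f i j hi hi' hj hj' hjn)
  rwa [zpow_neg, inv_inv] at this

theorem ki_mul_ki_e (h : LeviSystem q n k ki e f) (hq : q ≠ 0) {a b j : ℕ} (ha : 1 ≤ a)
    (ha' : a ≤ 2 * n) (hb : 1 ≤ b) (hb' : b ≤ 2 * n) (hj : 1 ≤ j) (hj' : j + 1 ≤ 2 * n)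
    (hjn : j ≠ n) :
    ki a * ki b * e j = (q ^ (-(rootPairing a j + rootPairing b j))) • (e j * (ki a * ki b)) := by
  rw [mul_assoc, h.ki_e hq hb hb' hj hj' hjn, mul_smul_comm,
    mul_left_rule (h.ki_e hq ha ha' hj hj' hjn), smul_smul, ← zpow_add₀ hq]
  congr 2
  ring

theorem ki_mul_ki_f (h : LeviSystem q n k ki e f) (hq : q ≠ 0) {a b j : ℕ} (ha : 1 ≤ a)
    (ha' : a ≤ 2 * n) (hb : 1 ≤ b) (hb' : b ≤ 2 * n) (hj : 1 ≤ j) (hj' : j + 1 ≤ 2 * n)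
    (hjn : j ≠ n) :
    ki a * ki b * f j = (q ^ (rootPairing a j + rootPairing b j)) • (f j * (ki a * ki b)) := by
  rw [mul_assoc, h.ki_f hq hb hb' hj hj' hjn, mul_smul_comm,
    mul_left_rule (h.ki_f hq ha ha' hj hj' hjn), smul_smul, ← zpow_add₀ hq]
  congr 2
  ring

theorem ki_mul_ki_comm (h : LeviSystem q n k ki e f) (a b c d : ℕ) :
    ki a * ki b * (ki c * ki d) = ki c * ki d * (ki a * ki b) :=
  ((Commute.mul_right (h.ki_comm a c) (h.ki_comm a d)).mul_left
    (Commute.mul_right (h.ki_comm b c) (h.ki_comm b d))).eq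

end LeviSystem

section Summands

variable {A : Type*} [Ring A]

/-- The lowering summand `y_j K_{j+1}⁻¹ K_{2n-j}⁻¹` of `B_j`. -/
def bLower (n : ℕ) (ki f : ℕ → A) (j : ℕ) : A := f j * (ki (j + 1) * ki (2 * n - j))

/-- The raising summand of `B_j` (`j ≠ n`), with the torus part moved to the right. -/
def bUpper (n : ℕ) (ki e : ℕ → A) (j : ℕ) : A := e (2 * n - j) * (ki j * ki (2 * n - j))

end Summands

namespace LeviSystem

variable {A : Type*} [Ring A] [Algebra ℂ A] {q : ℂ} {n : ℕ} {k ki e f : ℕ → A}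

theorem bUpper_eq (h : LeviSystem q n k ki e f) (hq : q ≠ 0) {j : ℕ} (hj : 1 ≤ j)
    (hj' : j + 1 ≤ 2 * n) (hjn : j ≠ n) :
    ki j * e (2 * n - j) * ki (2 * n - j) = bUpper n ki e j := by
  have hz : rootPairing j (2 * n - j) = 0 := by
    unfold rootPairing kd; split_ifs <;> omega
  rw [h.ki_e hq hj (by omega) (by omega) (by omega) (by omega), hz, bUpper]
  simp [mul_assoc]

theorem bLower_comm (h : LeviSystem q n k ki e f) (hq : q ≠ 0) {i j : ℕ} (hi : 1 ≤ i)
    (hi' : i + 1 ≤ 2 * n) (hin : i ≠ n) (hj : 1 ≤ j) (hj' : j + 1 ≤ 2 * n) (hjn : j ≠ n)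
    (hij : i + 2 ≤ j ∨ j + 2 ≤ i) :
    bLower n ki f i * bLower n ki f j = bLower n ki f j * bLower n ki f i := by
  have hz : rootPairing (i + 1) j + rootPairing (2 * n - i) j
      = rootPairing (j + 1) i + rootPairing (2 * n - j) i := by
    unfold rootPairing kd; split_ifs <;> omega
  have := mul_mul_swap (zpow_ne_zero _ hq) (h.f_f i j hi hi' hin hj hj' hjn hij)
    (h.ki_mul_ki_f hq (a := i + 1) (b := 2 * n - i) (by omega) (by omega) (by omega)
      (by omega) hj hj' hjn)
    (h.ki_mul_ki_f hq (a := j + 1) (b := 2 * n - j) (by omega) (by omega) (by omega)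
      (by omega) hi hi' hin) (h.ki_mul_ki_comm _ _ _ _)
  rwa [hz, mul_inv_cancel₀ (zpow_ne_zero _ hq), one_smul] at this

theorem bUpper_comm (h : LeviSystem q n k ki e f) (hq : q ≠ 0) {i j : ℕ} (hi : 1 ≤ i)
    (hi' : i + 1 ≤ 2 * n) (hin : i ≠ n) (hj : 1 ≤ j) (hj' : j + 1 ≤ 2 * n) (hjn : j ≠ n)
    (hij : i + 2 ≤ j ∨ j + 2 ≤ i) :
    bUpper n ki e i * bUpper n ki e j = bUpper n ki e j * bUpper n ki e i := by
  have hz : rootPairing i (2 * n - j) + rootPairing (2 * n - i) (2 * n - j)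
      = rootPairing j (2 * n - i) + rootPairing (2 * n - j) (2 * n - i) := by
    unfold rootPairing kd; split_ifs <;> omega
  have := mul_mul_swap (zpow_ne_zero _ hq)
    (h.e_e (2 * n - i) (2 * n - j) (by omega) (by omega) (by omega) (by omega) (by omega)
      (by omega) (by omega))
    (h.ki_mul_ki_e hq (a := i) (b := 2 * n - i) (j := 2 * n - j) (by omega) (by omega)
      (by omega) (by omega) (by omega) (by omega) (by omega))
    (h.ki_mul_ki_e hq (a := j) (b := 2 * n - j) (j := 2 * n - i) (by omega) (by omega)
      (by omega) (by omega) (by omega) (by omega) (by omega)) (h.ki_mul_ki_comm _ _ _ _)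
  rwa [hz, mul_inv_cancel₀ (zpow_ne_zero _ hq), one_smul] at this

theorem bLower_bUpper (h : LeviSystem q n k ki e f) (hq : q ≠ 0) {i j : ℕ} (hi : 1 ≤ i)
    (hi' : i + 1 ≤ 2 * n) (hin : i ≠ n) (hj : 1 ≤ j) (hj' : j + 1 ≤ 2 * n) (hjn : j ≠ n)
    (hij : i + j ≠ 2 * n) :
    bLower n ki f i * bUpper n ki e j =
      (q ^ (-(rootPairing (i + 1) (2 * n - j) + rootPairing (2 * n - i) (2 * n - j)
        + (rootPairing j i + rootPairing (2 * n - j) i)))) •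
        (bUpper n ki e j * bLower n ki f i) := by
  have := mul_mul_swap (zpow_ne_zero _ hq)
    (h.e_f_comm (2 * n - j) i (by omega) (by omega) (by omega) hi hi' hin (by omega)).symm
    (h.ki_mul_ki_e hq (a := i + 1) (b := 2 * n - i) (j := 2 * n - j) (by omega) (by omega)
      (by omega) (by omega) (by omega) (by omega) (by omega))
    (h.ki_mul_ki_f hq (a := j) (b := 2 * n - j) (by omega) (by omega)
      (by omega) (by omega) hi hi' hin) (h.ki_mul_ki_comm _ _ _ _)
  rwa [← zpow_neg, ← zpow_add₀ hq, ← neg_add] at this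

theorem bLower_bUpper_comm (h : LeviSystem q n k ki e f) (hq : q ≠ 0) {i j : ℕ} (hi : 1 ≤ i)
    (hi' : i + 1 ≤ 2 * n) (hin : i ≠ n) (hj : 1 ≤ j) (hj' : j + 1 ≤ 2 * n) (hjn : j ≠ n)
    (hij : i + j ≠ 2 * n) (hd : i + 2 ≤ j ∨ j + 2 ≤ i) :
    bLower n ki f i * bUpper n ki e j = bUpper n ki e j * bLower n ki f i := by
  have hz : rootPairing (i + 1) (2 * n - j) + rootPairing (2 * n - i) (2 * n - j)
        + (rootPairing j i + rootPairing (2 * n - j) i) = 0 := by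
    unfold rootPairing kd; split_ifs <;> omega
  rw [h.bLower_bUpper hq hi hi' hin hj hj' hjn hij, hz, neg_zero, zpow_zero, one_smul]

end LeviSystem

section Generators

variable {A : Type*} [Ring A] [Algebra ℂ A]

/-- The image of `β_n`: a combination of `K_{n+1}⁻²` and `K_n⁻²`. -/
noncomputable def bMiddle (q s t : ℂ) (n : ℕ) (ki : ℕ → A) : A :=
  (q - q⁻¹)⁻¹ • (s • ki (n + 1) ^ 2 - t • ki n ^ 2)

/-- The images of the generators `β_j` of `𝒜`. -/
noncomputable def bGen (q s t : ℂ) (n : ℕ) (ki e f : ℕ → A) (j : ℕ) : A :=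
  if j = n then bMiddle q s t n ki else bLower n ki f j + bUpper n ki e j

end Generators

namespace LeviSystem

variable {A : Type*} [Ring A] [Algebra ℂ A] {q : ℂ} {n : ℕ} {k ki e f : ℕ → A}

theorem ki_sq_bLower (h : LeviSystem q n k ki e f) (hq : q ≠ 0) {i j : ℕ} (hi : 1 ≤ i)
    (hi' : i ≤ 2 * n) (hj : 1 ≤ j) (hj' : j + 1 ≤ 2 * n) (hjn : j ≠ n) :
    ki i ^ 2 * bLower n ki f j =
      (q ^ (rootPairing i j + rootPairing i j)) • (bLower n ki f j * ki i ^ 2) := by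
  rw [bLower, pow_two, ← mul_assoc, h.ki_mul_ki_f hq hi hi' hi hi' hj hj' hjn, smul_mul_assoc,
    mul_assoc (f j), h.ki_mul_ki_comm, ← mul_assoc (f j)]

theorem ki_sq_bUpper (h : LeviSystem q n k ki e f) (hq : q ≠ 0) {i j : ℕ} (hi : 1 ≤ i)
    (hi' : i ≤ 2 * n) (hj : 1 ≤ j) (hj' : j + 1 ≤ 2 * n) (hjn : j ≠ n) :
    ki i ^ 2 * bUpper n ki e j =
      (q ^ (-(rootPairing i (2 * n - j) + rootPairing i (2 * n - j)))) •
        (bUpper n ki e j * ki i ^ 2) := by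
  rw [bUpper, pow_two, ← mul_assoc, h.ki_mul_ki_e hq hi hi' hi hi' (by omega) (by omega)
    (by omega), smul_mul_assoc, mul_assoc (e _), h.ki_mul_ki_comm,
    ← mul_assoc (e _)]

theorem ki_sq_bLower_of_eq (h : LeviSystem q n k ki e f) (hq : q ≠ 0) {i j : ℕ} {m : ℤ}
    (hi : 1 ≤ i) (hi' : i ≤ 2 * n) (hj : 1 ≤ j) (hj' : j + 1 ≤ 2 * n) (hjn : j ≠ n)
    (hm : rootPairing i j = m) :
    ki i ^ 2 * bLower n ki f j = ((q ^ m) ^ 2) • (bLower n ki f j * ki i ^ 2) := by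
  rw [h.ki_sq_bLower hq hi hi' hj hj' hjn, hm, zpow_add₀ hq, pow_two (q ^ m)]

theorem ki_sq_bUpper_of_eq (h : LeviSystem q n k ki e f) (hq : q ≠ 0) {i j : ℕ} {m : ℤ}
    (hi : 1 ≤ i) (hi' : i ≤ 2 * n) (hj : 1 ≤ j) (hj' : j + 1 ≤ 2 * n) (hjn : j ≠ n)
    (hm : -rootPairing i (2 * n - j) = m) :
    ki i ^ 2 * bUpper n ki e j = ((q ^ m) ^ 2) • (bUpper n ki e j * ki i ^ 2) := by
  rw [h.ki_sq_bUpper hq hi hi' hj hj' hjn, neg_add, hm, zpow_add₀ hq, pow_two (q ^ m)]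

theorem bLower_bUpper_bracket (h : LeviSystem q n k ki e f) (hq : q ≠ 0) {i : ℕ} (hi : 1 ≤ i)
    (hi' : i + 1 ≤ 2 * n) (hin : i ≠ n) :
    bLower n ki f i * bUpper n ki e (2 * n - i) - bUpper n ki e (2 * n - i) * bLower n ki f i =
      -((q * (q - q⁻¹)⁻¹) • ((ki (i + 1) ^ 2 - ki i ^ 2) * ki (2 * n - i) ^ 2)) := by
  have hii : 2 * n - (2 * n - i) = i := by omega
  have z₁ : -(rootPairing (i + 1) i + rootPairing (2 * n - i) i) = 1 := by
    unfold rootPairing kd; split_ifs <;> omega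
  have z₂ : rootPairing (2 * n - i) i + rootPairing i i = 1 := by
    unfold rootPairing kd; split_ifs <;> omega
  have hT := h.ki_mul_ki_e hq (a := i + 1) (b := 2 * n - i) (j := i) (by omega) (by omega)
    (by omega) (by omega) hi hi' hin
  have hS := h.ki_mul_ki_f hq (a := 2 * n - i) (b := i) (j := i) (by omega) (by omega)
    (by omega) (by omega) hi hi' hin
  rw [z₁, zpow_one] at hT
  rw [z₂, zpow_one] at hS
  have hTS := h.ki_mul_ki_comm (i + 1) (2 * n - i) (2 * n - i) i
  have hcancel := torus_cancel (h.k_ki i) (h.k_ki (i + 1)) (h.ki_comm_k (i + 1) i).symm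
    (h.ki_comm i (i + 1)) (h.ki_comm i (2 * n - i))
  rw [bLower, bUpper, hii]
  generalize hTdef : ki (i + 1) * ki (2 * n - i) = T at *
  generalize hSdef : ki (2 * n - i) * ki i = S at *
  have key : f i * T * (e i * S) - e i * S * (f i * T) =
      -(q • ((e i * f i - f i * e i) * (T * S))) := by
    simp only [mul_assoc, mul_left_rule hT, mul_left_rule hS, mul_smul_comm, hTS, sub_mul]
    module
  rw [key, h.e_f i hi hi' hin, smul_mul_assoc, hcancel, smul_smul]

/-- The commutator of `B_i` and `B_{2n-i}`. -/
theorem bracket_dual (h : LeviSystem q n k ki e f) (hq : q ≠ 0) {i : ℕ} (hi : 1 ≤ i)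
    (hi' : i + 1 ≤ 2 * n) (hin : i ≠ n) :
    (bLower n ki f i + bUpper n ki e i) *
        (bLower n ki f (2 * n - i) + bUpper n ki e (2 * n - i)) -
      (bLower n ki f (2 * n - i) + bUpper n ki e (2 * n - i)) *
        (bLower n ki f i + bUpper n ki e i) =
      (q * (q - q⁻¹)⁻¹) • ((ki i * ki (2 * n + 1 - i)) ^ 2 - (ki (i + 1) * ki (2 * n - i)) ^ 2) := by
  have hii : 2 * n - (2 * n - i) = i := by omega
  have hsucc : 2 * n - i + 1 = 2 * n + 1 - i := by omega
  have h₁ := h.bLower_bUpper_bracket hq hi hi' hin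
  have h₂ := h.bLower_bUpper_bracket hq (i := 2 * n - i) (by omega) (by omega) (by omega)
  rw [hii, hsucc] at h₂
  have h₃ := h.bLower_comm hq hi hi' hin (j := 2 * n - i) (by omega) (by omega) (by omega)
    (by omega)
  have h₄ := h.bUpper_comm hq hi hi' hin (j := 2 * n - i) (by omega) (by omega) (by omega)
    (by omega)
  rw [(show Commute (ki i) (ki (2 * n + 1 - i)) from h.ki_comm _ _).mul_pow,
    (show Commute (ki (i + 1)) (ki (2 * n - i)) from h.ki_comm _ _).mul_pow]
  have c₁ : ki (2 * n + 1 - i) ^ 2 * ki i ^ 2 = ki i ^ 2 * ki (2 * n + 1 - i) ^ 2 :=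
    (show Commute (ki (2 * n + 1 - i)) (ki i) from h.ki_comm _ _).pow_pow 2 2
  have c₂ : ki (2 * n - i) ^ 2 * ki i ^ 2 = ki i ^ 2 * ki (2 * n - i) ^ 2 :=
    (show Commute (ki (2 * n - i)) (ki i) from h.ki_comm _ _).pow_pow 2 2
  rw [sub_mul] at h₁ h₂
  rw [c₁, c₂] at h₂
  simp only [add_mul, mul_add]
  rw [h₃, h₄]
  calc _ = (bLower n ki f i * bUpper n ki e (2 * n - i)
          - bUpper n ki e (2 * n - i) * bLower n ki f i)
        - (bLower n ki f (2 * n - i) * bUpper n ki e i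
          - bUpper n ki e i * bLower n ki f (2 * n - i)) := by abel
    _ = _ := by
      rw [h₁, h₂]
      module

theorem bracket_of_add_ne (h : LeviSystem q n k ki e f) (hq : q ≠ 0) {i j : ℕ} (hi : 1 ≤ i)
    (hi' : i + 1 ≤ 2 * n) (hin : i ≠ n) (hj : 1 ≤ j) (hj' : j + 1 ≤ 2 * n) (hjn : j ≠ n)
    (hij : i + j ≠ 2 * n) (hd : i + 2 ≤ j ∨ j + 2 ≤ i) :
    Commute (bLower n ki f i + bUpper n ki e i) (bLower n ki f j + bUpper n ki e j) :=
  .add_left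
    (.add_right (h.bLower_comm hq hi hi' hin hj hj' hjn hd)
      (h.bLower_bUpper_comm hq hi hi' hin hj hj' hjn hij hd))
    (.add_right (h.bLower_bUpper_comm hq hj hj' hjn hi hi' hin (by omega) hd.symm).symm
      (h.bUpper_comm hq hi hi' hin hj hj' hjn hd))

theorem bMiddle_comm (h : LeviSystem q n k ki e f) (hq : q ≠ 0) (s t : ℂ) {j : ℕ}
    (hj : 1 ≤ j) (hj' : j + 1 ≤ 2 * n) (hd : n + 2 ≤ j ∨ j + 2 ≤ n) :
    Commute (bMiddle q s t n ki) (bLower n ki f j + bUpper n ki e j) := by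
  have comm : ∀ i, i = n ∨ i = n + 1 →
      Commute (ki i ^ 2) (bLower n ki f j + bUpper n ki e j) := by
    intro i hi
    have z₁ : rootPairing i j = 0 := by unfold rootPairing kd; split_ifs <;> omega
    have z₂ : -rootPairing i (2 * n - j) = 0 := by
      unfold rootPairing kd; split_ifs <;> omega
    have h₁ := h.ki_sq_bLower_of_eq hq (by omega) (by omega) hj hj' (by omega) z₁
    have h₂ := h.ki_sq_bUpper_of_eq hq (by omega) (by omega) hj hj' (by omega) z₂
    rw [zpow_zero, one_pow, one_smul] at h₁ h₂
    exact .add_right h₁ h₂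
  exact (((comm _ (.inr rfl)).smul_left s).sub_left ((comm _ (.inl rfl)).smul_left t)).smul_left _

/-- The Serre-type relation between `B_i` and `B_{i+1}` away from `n`. -/
theorem qSerre_succ (h : LeviSystem q n k ki e f) (hq : q ≠ 0) {i : ℕ} (hi : 1 ≤ i)
    (hi' : i + 2 ≤ 2 * n) (hin : i ≠ n) (hin' : i + 1 ≠ n) :
    qSerre q (bLower n ki f i + bUpper n ki e i)
      (bLower n ki f (i + 1) + bUpper n ki e (i + 1)) = 0 := by
  refine qSerre_add_add hq ?_ ?_ ?_ ?_ ?_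
  · refine qSerre_mul_torus hq (h.ki_mul_ki_f hq (by omega) (by omega) (by omega) (by omega) hi
        (by omega) hin) (d := 1) ?_ ?_ (h.ki_mul_ki_comm _ _ _ _)
        (h.f_serre i (i + 1) hi (by omega) hin (by omega) (by omega) hin' (by omega))
    · have z : rootPairing (i + 1) (i + 1) + rootPairing (2 * n - i) (i + 1) = 1 := by
        unfold rootPairing kd; split_ifs <;> omega
      rw [h.ki_mul_ki_f hq (by omega) (by omega) (by omega) (by omega) (by omega) (by omega) hin',
        z, zpow_one, mul_one]
    · have z : rootPairing (i + 1 + 1) i + rootPairing (2 * n - (i + 1)) i = 0 := by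
        unfold rootPairing kd; split_ifs <;> omega
      rw [h.ki_mul_ki_f hq (by omega) (by omega) (by omega) (by omega) (by omega) (by omega) hin,
        z, zpow_zero]
  · refine qSerre_mul_torus hq (h.ki_mul_ki_e hq (by omega) (by omega) (by omega) (by omega)
        (by omega) (by omega) (by omega)) (d := 1) ?_ ?_ (h.ki_mul_ki_comm _ _ _ _)
        (h.e_serre _ _ (by omega) (by omega) (by omega) (by omega) (by omega) (by omega)
          (by omega))
    · have z : -(rootPairing i (2 * n - (i + 1)) + rootPairing (2 * n - i) (2 * n - (i + 1)))
          = 1 := by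
        unfold rootPairing kd; split_ifs <;> omega
      rw [h.ki_mul_ki_e hq (by omega) (by omega) (by omega) (by omega) (by omega) (by omega)
        (by omega), z, zpow_one, mul_one]
    · have z : -(rootPairing (i + 1) (2 * n - i) + rootPairing (2 * n - (i + 1)) (2 * n - i))
          = 0 := by
        unfold rootPairing kd; split_ifs <;> omega
      rw [h.ki_mul_ki_e hq (by omega) (by omega) (by omega) (by omega) (by omega) (by omega)
        (by omega), z, zpow_zero]
  · have z : -(rootPairing (i + 1) (2 * n - i) + rootPairing (2 * n - i) (2 * n - i)
        + (rootPairing i i + rootPairing (2 * n - i) i)) = -2 := by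
      unfold rootPairing kd; split_ifs <;> omega
    rw [h.bLower_bUpper hq hi (by omega) hin hi (by omega) hin (by omega), z, smul_smul,
      ← zpow_natCast q 2, ← zpow_add₀ hq]
    simp
  · have z : -(rootPairing (i + 1) (2 * n - (i + 1)) + rootPairing (2 * n - i) (2 * n - (i + 1))
        + (rootPairing (i + 1) i + rootPairing (2 * n - (i + 1)) i)) = (2 : ℕ) := by
      unfold rootPairing kd; split_ifs <;> omega
    rw [h.bLower_bUpper hq hi (by omega) hin (by omega) (by omega) hin' (by omega), z,
      zpow_natCast]
  · have z : -(rootPairing (i + 1 + 1) (2 * n - i) + rootPairing (2 * n - (i + 1)) (2 * n - i)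
        + (rootPairing i (i + 1) + rootPairing (2 * n - i) (i + 1))) = 0 := by
      unfold rootPairing kd; split_ifs <;> omega
    rw [h.bLower_bUpper hq (by omega) (by omega) hin' hi (by omega) hin (by omega), z, zpow_zero,
      one_smul]

/-- The Serre-type relation between `B_{i+1}` and `B_i` away from `n`. -/
theorem qSerre_pred (h : LeviSystem q n k ki e f) (hq : q ≠ 0) {i : ℕ} (hi : 1 ≤ i)
    (hi' : i + 2 ≤ 2 * n) (hin : i ≠ n) (hin' : i + 1 ≠ n) :
    qSerre q⁻¹ (bLower n ki f (i + 1) + bUpper n ki e (i + 1))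
      (bLower n ki f i + bUpper n ki e i) = 0 := by
  rw [add_comm (bLower n ki f (i + 1)), add_comm (bLower n ki f i)]
  refine qSerre_add_add (inv_ne_zero hq) ?_ ?_ ?_ ?_ ?_
  · refine qSerre_mul_torus (inv_ne_zero hq) (h.ki_mul_ki_e hq (by omega) (by omega) (by omega)
        (by omega) (by omega) (by omega) (by omega)) (d := q) ?_ ?_ (h.ki_mul_ki_comm _ _ _ _)
        ?_
    · have z : -(rootPairing (i + 1) (2 * n - i) + rootPairing (2 * n - (i + 1)) (2 * n - i))
          = 0 := by
        unfold rootPairing kd; split_ifs <;> omega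
      rw [h.ki_mul_ki_e hq (by omega) (by omega) (by omega) (by omega) (by omega) (by omega)
        (by omega), z, zpow_zero, inv_mul_cancel₀ hq]
    · have z : -(rootPairing i (2 * n - (i + 1)) + rootPairing (2 * n - i) (2 * n - (i + 1)))
          = 1 := by
        unfold rootPairing kd; split_ifs <;> omega
      rw [h.ki_mul_ki_e hq (by omega) (by omega) (by omega) (by omega) (by omega) (by omega)
        (by omega), z, zpow_one]
    · rw [inv_inv, add_comm q⁻¹]
      exact h.e_serre _ _ (by omega) (by omega) (by omega) (by omega) (by omega) (by omega)
        (by omega)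
  · refine qSerre_mul_torus (inv_ne_zero hq) (h.ki_mul_ki_f hq (by omega) (by omega) (by omega)
        (by omega) (by omega) (by omega) hin') (d := q) ?_ ?_ (h.ki_mul_ki_comm _ _ _ _)
        ?_
    · have z : rootPairing (i + 1 + 1) i + rootPairing (2 * n - (i + 1)) i = 0 := by
        unfold rootPairing kd; split_ifs <;> omega
      rw [h.ki_mul_ki_f hq (by omega) (by omega) (by omega) (by omega) (by omega) (by omega) hin,
        z, zpow_zero, inv_mul_cancel₀ hq]
    · have z : rootPairing (i + 1) (i + 1) + rootPairing (2 * n - i) (i + 1) = 1 := by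
        unfold rootPairing kd; split_ifs <;> omega
      rw [h.ki_mul_ki_f hq (by omega) (by omega) (by omega) (by omega) (by omega) (by omega) hin',
        z, zpow_one]
    · rw [inv_inv, add_comm q⁻¹]
      exact h.f_serre (i + 1) i (by omega) (by omega) hin' hi (by omega) hin (by omega)
  · have z : -(rootPairing (i + 1 + 1) (2 * n - (i + 1))
        + rootPairing (2 * n - (i + 1)) (2 * n - (i + 1))
        + (rootPairing (i + 1) (i + 1) + rootPairing (2 * n - (i + 1)) (i + 1))) = -(2 : ℕ) := by
      unfold rootPairing kd; split_ifs <;> omega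
    rw [h.bLower_bUpper hq (by omega) (by omega) hin' (by omega) (by omega) hin' (by omega), z,
      zpow_neg, zpow_natCast, inv_pow]
  · have z : -(rootPairing (i + 1) (2 * n - (i + 1)) + rootPairing (2 * n - i) (2 * n - (i + 1))
        + (rootPairing (i + 1) i + rootPairing (2 * n - (i + 1)) i)) = (2 : ℕ) := by
      unfold rootPairing kd; split_ifs <;> omega
    rw [h.bLower_bUpper hq hi (by omega) hin (by omega) (by omega) hin' (by omega), z,
      zpow_natCast, smul_smul, inv_pow, inv_mul_cancel₀ (pow_ne_zero 2 hq), one_smul]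
  · have z : -(rootPairing (i + 1 + 1) (2 * n - i) + rootPairing (2 * n - (i + 1)) (2 * n - i)
        + (rootPairing i (i + 1) + rootPairing (2 * n - i) (i + 1))) = 0 := by
      unfold rootPairing kd; split_ifs <;> omega
    rw [h.bLower_bUpper hq (by omega) (by omega) hin' hi (by omega) hin (by omega), z, zpow_zero,
      one_smul]

theorem bLower_mul_bUpper_self (h : LeviSystem q n k ki e f) (hq : q ≠ 0) (hn : 2 ≤ n) {i : ℕ}
    (hi : i + 1 = n ∨ i = n + 1) :
    bLower n ki f i * bUpper n ki e i = 0 ∧ bUpper n ki e i * bLower n ki f i = 0 := by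
  have hef : e (2 * n - i) * f i = 0 := by
    rcases hi with hi | rfl
    · rw [show 2 * n - i = n + 1 by omega, show i = n - 1 by omega, h.e_f_succ]
    · rw [show 2 * n - (n + 1) = n - 1 by omega, h.e_f_pred]
  have h₂ : bUpper n ki e i * bLower n ki f i = 0 := by
    rw [bUpper, bLower, mul_assoc, ← mul_assoc (ki i * _), h.ki_mul_ki_f hq (by omega) (by omega)
      (by omega) (by omega) (by omega) (by omega) (by omega), smul_mul_assoc, mul_smul_comm,
      mul_assoc, ← mul_assoc, hef, zero_mul, smul_zero]
  refine ⟨?_, h₂⟩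
  rw [h.bLower_bUpper hq (by omega) (by omega) (by omega) (by omega) (by omega) (by omega)
    (by omega), h₂, smul_zero]

theorem qSerre_bMiddle_right (h : LeviSystem q n k ki e f) (hq : q ≠ 0) (hn : 2 ≤ n) (s t : ℂ) :
    qSerre q (bLower n ki f (n - 1) + bUpper n ki e (n - 1)) (bMiddle q s t n ki) = 0 ∧
    qSerre q⁻¹ (bLower n ki f (n + 1) + bUpper n ki e (n + 1)) (bMiddle q s t n ki) = 0 := by
  have serre : ∀ (p : ℂ) (i j : ℕ) (a b : ℤ), (j + 1 = n ∨ j = n + 1) → (i = n ∨ i = n + 1) →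
      rootPairing i j = a → -rootPairing i (2 * n - j) = b →
      p⁻¹ - (p + p⁻¹) * (q ^ a) ^ 2 + p * ((q ^ a) ^ 2) ^ 2 = 0 →
      p⁻¹ - (p + p⁻¹) * (q ^ b) ^ 2 + p * ((q ^ b) ^ 2) ^ 2 = 0 →
      qSerre p (bLower n ki f j + bUpper n ki e j) (ki i ^ 2) = 0 := by
    intro p i j a b hj hi ha hb hpa hpb
    have hxy := h.bLower_mul_bUpper_self hq hn hj
    exact qSerre_add_of_mul_eq_zero hxy.1 hxy.2
      (h.ki_sq_bLower_of_eq hq (by omega) (by omega) (by omega) (by omega) (by omega) ha)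
      (h.ki_sq_bUpper_of_eq hq (by omega) (by omega) (by omega) (by omega) (by omega) hb) hpa hpb
  have expand : ∀ (p : ℂ) (x : A), qSerre p x (bMiddle q s t n ki) =
      (q - q⁻¹)⁻¹ • (s • qSerre p x (ki (n + 1) ^ 2) - t • qSerre p x (ki n ^ 2)) := by
    intro p x
    rw [bMiddle, qSerre_smul_right, sub_eq_add_neg (s • _), ← neg_smul, qSerre_add_right,
      qSerre_smul_right, qSerre_smul_right, neg_smul, ← sub_eq_add_neg]
  constructor
  · rw [expand, serre q (n + 1) (n - 1) 0 (-1) (by omega) (by omega)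
        (by unfold rootPairing kd; split_ifs <;> omega)
        (by unfold rootPairing kd; split_ifs <;> omega)
        (by simp) (by simp; field_simp; ring),
      serre q n (n - 1) (-1) 0 (by omega) (by omega)
        (by unfold rootPairing kd; split_ifs <;> omega)
        (by unfold rootPairing kd; split_ifs <;> omega)
        (by simp; field_simp; ring) (by simp)]
    simp
  · rw [expand, serre q⁻¹ (n + 1) (n + 1) 1 0 (by omega) (by omega)
        (by unfold rootPairing kd; split_ifs <;> omega)
        (by unfold rootPairing kd; split_ifs <;> omega)
        (by simp; field_simp; ring) (by simp),
      serre q⁻¹ n (n + 1) 0 1 (by omega) (by omega)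
        (by unfold rootPairing kd; split_ifs <;> omega)
        (by unfold rootPairing kd; split_ifs <;> omega)
        (by simp) (by simp; field_simp; ring)]
    simp

theorem qSerre_bMiddle_left (h : LeviSystem q n k ki e f) (hq : q ≠ 0) (hqq : q - q⁻¹ ≠ 0)
    (hn : 2 ≤ n) {s t : ℂ} (hst : s * t = 1) :
    qSerre q (bMiddle q s t n ki) (bLower n ki f (n + 1) + bUpper n ki e (n + 1)) =
      q • ((bLower n ki f (n + 1) + bUpper n ki e (n + 1)) * (ki n * ki (n + 1)) ^ 2) ∧
    qSerre q⁻¹ (bMiddle q s t n ki) (bLower n ki f (n - 1) + bUpper n ki e (n - 1)) =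
      q⁻¹ • ((bLower n ki f (n - 1) + bUpper n ki e (n - 1)) * (ki n * ki (n + 1)) ^ 2) := by
  have hc : ki (n + 1) ^ 2 * ki n ^ 2 = ki n ^ 2 * ki (n + 1) ^ 2 :=
    (show Commute (ki (n + 1)) (ki n) from h.ki_comm _ _).pow_pow 2 2
  have hpow : (ki n * ki (n + 1)) ^ 2 = ki n ^ 2 * ki (n + 1) ^ 2 :=
    (show Commute (ki n) (ki (n + 1)) from h.ki_comm _ _).mul_pow 2
  have hr : (q - q⁻¹)⁻¹ ^ 2 * (q - q⁻¹) ^ 2 = 1 := by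
    rw [← mul_pow, inv_mul_cancel₀ hqq, one_pow]
  have hr' : (q - q⁻¹)⁻¹ ^ 2 * (q⁻¹ - q⁻¹⁻¹) ^ 2 = 1 := by
    rw [inv_inv, ← neg_sub q, neg_sq, hr]
  have hflip : bMiddle q s t n ki = (q - q⁻¹)⁻¹ • ((-t) • ki n ^ 2 - (-s) • ki (n + 1) ^ 2) := by
    rw [bMiddle]
    module
  have hts : (-t) * (-s) = 1 := by rw [neg_mul_neg, mul_comm, hst]
  have lower : ∀ (i j : ℕ) (a : ℤ), (j + 1 = n ∨ j = n + 1) → (i = n ∨ i = n + 1) →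
      rootPairing i j = a →
      ki i ^ 2 * bLower n ki f j = ((q ^ a) ^ 2) • (bLower n ki f j * ki i ^ 2) :=
    fun i j a hj hi ha =>
      h.ki_sq_bLower_of_eq hq (by omega) (by omega) (by omega) (by omega) (by omega) ha
  have upper : ∀ (i j : ℕ) (a : ℤ), (j + 1 = n ∨ j = n + 1) → (i = n ∨ i = n + 1) →
      -rootPairing i (2 * n - j) = a →
      ki i ^ 2 * bUpper n ki e j = ((q ^ a) ^ 2) • (bUpper n ki e j * ki i ^ 2) :=
    fun i j a hj hi ha =>
      h.ki_sq_bUpper_of_eq hq (by omega) (by omega) (by omega) (by omega) (by omega) ha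
  rw [qSerre_add_right, qSerre_add_right, add_mul, add_mul, smul_add, smul_add, hpow]
  refine ⟨congrArg₂ _ ?_ ?_, congrArg₂ _ ?_ ?_⟩
  · rw [← hc]
    refine qSerre_torus hq ?_ ?_ hc hr hst
    · simpa using lower (n + 1) (n + 1) 1 (by omega) (by omega)
        (by unfold rootPairing kd; split_ifs <;> omega)
    · simpa using lower n (n + 1) 0 (by omega) (by omega)
        (by unfold rootPairing kd; split_ifs <;> omega)
  · rw [hflip]
    refine qSerre_torus hq ?_ ?_ hc.symm hr hts
    · simpa using upper n (n + 1) 1 (by omega) (by omega)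
        (by unfold rootPairing kd; split_ifs <;> omega)
    · simpa using upper (n + 1) (n + 1) 0 (by omega) (by omega)
        (by unfold rootPairing kd; split_ifs <;> omega)
  · rw [hflip]
    refine qSerre_torus (inv_ne_zero hq) ?_ ?_ hc.symm hr' hts
    · simpa using lower n (n - 1) (-1) (by omega) (by omega)
        (by unfold rootPairing kd; split_ifs <;> omega)
    · simpa using lower (n + 1) (n - 1) 0 (by omega) (by omega)
        (by unfold rootPairing kd; split_ifs <;> omega)
  · rw [← hc]
    refine qSerre_torus (inv_ne_zero hq) ?_ ?_ hc hr' hst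
    · simpa using upper (n + 1) (n - 1) (-1) (by omega) (by omega)
        (by unfold rootPairing kd; split_ifs <;> omega)
    · simpa using upper n (n - 1) 0 (by omega) (by omega)
        (by unfold rootPairing kd; split_ifs <;> omega)

theorem k_mul_k_bGen (h : LeviSystem q n k ki e f) (hq : q ≠ 0) (s t : ℂ) {i j : ℕ} (hi : 1 ≤ i)
    (hi' : i ≤ 2 * n) (hj : 1 ≤ j) (hj' : j + 1 ≤ 2 * n) :
    k i * k (2 * n + 1 - i) * bGen q s t n ki e f j =
      (q ^ (-gex n i j)) • (bGen q s t n ki e f j * (k i * k (2 * n + 1 - i))) := by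
  have hkk : ∀ a, Commute (k i * k (2 * n + 1 - i)) (ki a) := fun a =>
    Commute.mul_left (h.ki_comm_k a i).symm (h.ki_comm_k a _).symm
  rw [bGen]
  split_ifs with hjn
  · have z : gex n i j = 0 := by
      subst hjn; unfold gex kd; split_ifs <;> omega
    rw [z, neg_zero, zpow_zero, one_smul]
    exact ((((hkk _).pow_right 2).smul_right s).sub_right
      (((hkk _).pow_right 2).smul_right t)).smul_right _
  · have z₁ : -rootPairing (2 * n + 1 - i) j + -rootPairing i j = -gex n i j := by
      unfold rootPairing gex; ring
    have z₂ : rootPairing (2 * n + 1 - i) (2 * n - j) + rootPairing i (2 * n - j)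
        = -gex n i j := by
      unfold rootPairing gex kd; split_ifs <;> omega
    have h₁ : k i * k (2 * n + 1 - i) * bLower n ki f j =
        (q ^ (-gex n i j)) • (bLower n ki f j * (k i * k (2 * n + 1 - i))) := by
      rw [bLower, mul_assoc (f j), ← ((hkk _).mul_right (hkk _)).eq, mul_assoc, mul_left_rule (h.k_f _ _ (by omega) (by omega) hj hj' hjn), mul_smul_comm,
        mul_left_rule (h.k_f _ _ hi hi' hj hj' hjn), smul_smul, ← zpow_add₀ hq, z₁, mul_assoc]
    have h₂ : k i * k (2 * n + 1 - i) * bUpper n ki e j =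
        (q ^ (-gex n i j)) • (bUpper n ki e j * (k i * k (2 * n + 1 - i))) := by
      rw [bUpper, mul_assoc (e _), ← ((hkk _).mul_right (hkk _)).eq, mul_assoc, mul_left_rule (h.k_e _ _ (by omega) (by omega) (by omega) (by omega)
        (by omega)), mul_smul_comm, mul_left_rule (h.k_e _ _ hi hi' (by omega) (by omega)
        (by omega)), smul_smul, ← zpow_add₀ hq, z₂, mul_assoc]
    rw [mul_add, h₁, h₂, add_mul, smul_add]

end LeviSystem

/-- The assignment of the generators of `𝒜` determined by elements `k, ki, e, f`. -/
noncomputable def genImage {A : Type*} [Ring A] [Algebra ℂ A] (q s t : ℂ) (n : ℕ)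
    (k ki e f : ℕ → A) : AGen → A
  | .g i => k i * k (2 * n + 1 - i)
  | .gi i => ki i * ki (2 * n + 1 - i)
  | .b j => bGen q s t n ki e f j

/-- The assignment of generators respects the defining relations of `𝒜`. -/
theorem LeviSystem.genImage_rel {A : Type*} [Ring A] [Algebra ℂ A] {q : ℝ} {n : ℕ}
    {k ki e f : ℕ → A} (h : LeviSystem (q : ℂ) n k ki e f) (hq : (q : ℂ) ≠ 0)
    (hqq : (q : ℂ) - (q : ℂ)⁻¹ ≠ 0) (hn : 2 ≤ n) {s t : ℂ} (hst : s * t = 1) ⦃x y : AFA⦄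
    (hxy : ARel q n x y) :
    FreeAlgebra.lift ℂ (genImage (q : ℂ) s t n k ki e f) x =
      FreeAlgebra.lift ℂ (genImage (q : ℂ) s t n k ki e f) y := by
  have g_mul_gi : ∀ i, k i * k (2 * n + 1 - i) * (ki i * ki (2 * n + 1 - i)) = 1 := fun i => by
    rw [mul_assoc, h.ki_comm i, ← mul_assoc (k (2 * n + 1 - i)), h.k_ki, one_mul, h.k_ki]
  have gi_mul_g : ∀ i, ki i * ki (2 * n + 1 - i) * (k i * k (2 * n + 1 - i)) = 1 := fun i => by
    rw [mul_assoc, h.k_k i, ← mul_assoc (ki (2 * n + 1 - i)), h.ki_k, one_mul, h.ki_k]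
  cases hxy with
  | gout i hi =>
    simp only [fγ, FreeAlgebra.lift_ι_apply, genImage, map_one]
    rw [h.k_out i hi, h.k_out _ (by omega), one_mul]
  | giout i hi =>
    simp only [fγi, FreeAlgebra.lift_ι_apply, genImage, map_one]
    rw [h.ki_out i hi, h.ki_out _ (by omega), one_mul]
  | bout j hj =>
    simp only [fβ, FreeAlgebra.lift_ι_apply, genImage, map_zero]
    rw [bGen, if_neg (by omega), bLower, bUpper, h.f_out j hj, h.e_out _ (by omega)]
    simp
  | gg i j =>
    simp only [fγ, FreeAlgebra.lift_ι_apply, genImage, map_mul]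
    exact ((Commute.mul_right (h.k_k _ _) (h.k_k _ _)).mul_left
      (Commute.mul_right (h.k_k _ _) (h.k_k _ _))).eq
  | ggi i =>
    simp only [fγ, fγi, FreeAlgebra.lift_ι_apply, genImage, map_mul, map_one, g_mul_gi]
  | gig i =>
    simp only [fγ, fγi, FreeAlgebra.lift_ι_apply, genImage, map_mul, map_one, gi_mul_g]
  | gsym i hi hi' =>
    simp only [fγ, FreeAlgebra.lift_ι_apply, genImage]
    rw [show 2 * n + 1 - (2 * n + 1 - i) = i by omega, h.k_k]
  | gb i j hi hi' hj hj' =>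
    simp only [fγ, fβ, FreeAlgebra.lift_ι_apply, genImage, map_mul, map_smul]
    exact h.k_mul_k_bGen hq s t hi hi' hj hj'
  | bb i j hi hi' hj hj' hd =>
    simp only [fβ, FreeAlgebra.lift_ι_apply, genImage, map_mul, map_sub]
    split_ifs with hij
    · obtain rfl : j = 2 * n - i := by omega
      simp only [fγi, FreeAlgebra.lift_ι_apply, genImage, map_sub, map_smul, map_pow]
      rw [bGen, bGen, if_neg (by omega), if_neg (by omega),
        show 2 * n + 1 - (i + 1) = 2 * n - i by omega]
      exact h.bracket_dual hq hi hi' (by omega)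
    · rw [map_zero, sub_eq_zero]
      by_cases hin : i = n
      · subst hin
        rw [bGen, bGen, if_pos rfl, if_neg (by omega)]
        exact h.bMiddle_comm hq s t hj hj' hd
      by_cases hjn : j = n
      · subst hjn
        rw [bGen, bGen, if_pos rfl, if_neg hin]
        exact (h.bMiddle_comm hq s t hi hi' hd.symm).symm
      · rw [bGen, bGen, if_neg hin, if_neg hjn]
        exact h.bracket_of_add_ne hq hi hi' hin hj hj' hjn hij hd
  | serre1 i hi hi' =>
    have serre : qSerre (q : ℂ) (bGen q s t n ki e f i) (bGen q s t n ki e f (i + 1)) =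
        if i = n then (q : ℂ) • (bGen q s t n ki e f (n + 1) * (ki n * ki (n + 1)) ^ 2)
        else 0 := by
      split_ifs with hin
      · subst hin
        rw [bGen, bGen, if_pos rfl, if_neg (by omega)]
        exact (h.qSerre_bMiddle_left hq hqq hn hst).1
      by_cases hin' : i + 1 = n
      · subst hin'
        rw [bGen, bGen, if_pos rfl, if_neg hin]
        exact (h.qSerre_bMiddle_right hq hn s t).1
      · rw [bGen, bGen, if_neg hin, if_neg hin']
        exact h.qSerre_succ hq hi hi' hin hin'
    rw [qSerre] at serre
    split_ifs at serre ⊢ <;>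
      simpa only [fβ, fγi, FreeAlgebra.lift_ι_apply, genImage, map_mul, map_sub, map_add, map_smul,
        map_pow, map_zero, show 2 * n + 1 - n = n + 1 by omega] using serre
  | serre2 i hi hi' =>
    have serre : qSerre (q : ℂ)⁻¹ (bGen q s t n ki e f i) (bGen q s t n ki e f (i - 1)) =
        if i = n then (q : ℂ)⁻¹ • (bGen q s t n ki e f (n - 1) * (ki n * ki (n + 1)) ^ 2)
        else 0 := by
      split_ifs with hin
      · subst hin
        rw [bGen, bGen, if_pos rfl, if_neg (by omega)]
        exact (h.qSerre_bMiddle_left hq hqq hn hst).2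
      obtain ⟨i, rfl⟩ : ∃ m, i = m + 1 := ⟨i - 1, by omega⟩
      rw [Nat.add_sub_cancel]
      by_cases hin' : i = n
      · subst hin'
        rw [bGen, bGen, if_pos rfl, if_neg hin]
        exact (h.qSerre_bMiddle_right hq hn s t).2
      · rw [bGen, bGen, if_neg hin, if_neg hin']
        exact h.qSerre_pred hq (by omega) hi' hin' hin
    rw [qSerre, inv_inv, add_comm (q : ℂ)⁻¹] at serre
    split_ifs at serre ⊢ <;>
      simpa only [fβ, fγi, FreeAlgebra.lift_ι_apply, genImage, map_mul, map_sub, map_add, map_smul,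
        map_pow, map_zero, show 2 * n + 1 - n = n + 1 by omega] using serre

section Quotient

variable {q : ℝ} {n : ℕ}

noncomputable instance : Ring (UkQ q n) := Algebra.semiringToRing ℂ

/-- The class in `U_q(k)/I` of an element of `U_q(gl(2n))`, with junk value `0` outside
`U_q(k)`. -/
noncomputable def ukClass (q : ℝ) (n : ℕ) (x : Uq q (2 * n)) : UkQ q n :=
  open Classical in if hx : x ∈ UkSub q n then ukmk q n ⟨x, hx⟩ else 0

theorem ukClass_coe (z : ↥(UkSub q n)) : ukClass q n z = ukmk q n z := by
  rw [ukClass, dif_pos z.2]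

theorem ukClass_one : ukClass q n 1 = 1 := by
  simpa using ukClass_coe (1 : ↥(UkSub q n))

theorem ukClass_zero : ukClass q n 0 = 0 := by
  simpa using ukClass_coe (0 : ↥(UkSub q n))

theorem ukClass_add {x y : Uq q (2 * n)} (hx : x ∈ UkSub q n) (hy : y ∈ UkSub q n) :
    ukClass q n (x + y) = ukClass q n x + ukClass q n y := by
  lift x to ↥(UkSub q n) using hx
  lift y to ↥(UkSub q n) using hy
  rw [ukClass_coe, ukClass_coe, ← map_add, ← ukClass_coe]
  rfl

theorem ukClass_mul {x y : Uq q (2 * n)} (hx : x ∈ UkSub q n) (hy : y ∈ UkSub q n) :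
    ukClass q n (x * y) = ukClass q n x * ukClass q n y := by
  lift x to ↥(UkSub q n) using hx
  lift y to ↥(UkSub q n) using hy
  rw [ukClass_coe, ukClass_coe, ← map_mul, ← ukClass_coe]
  rfl

theorem ukClass_smul (c : ℂ) {x : Uq q (2 * n)} (hx : x ∈ UkSub q n) :
    ukClass q n (c • x) = c • ukClass q n x := by
  lift x to ↥(UkSub q n) using hx
  rw [ukClass_coe, ← map_smul, ← ukClass_coe]
  rfl

theorem ukClass_sub {x y : Uq q (2 * n)} (hx : x ∈ UkSub q n) (hy : y ∈ UkSub q n) :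
    ukClass q n (x - y) = ukClass q n x - ukClass q n y := by
  rw [sub_eq_add_neg, sub_eq_add_neg, ← neg_one_smul ℂ y, ← neg_one_smul ℂ (ukClass q n y),
    ukClass_add hx (Subalgebra.smul_mem _ hy _), ukClass_smul _ hy]

theorem uK_mem (i : ℕ) : uK q (2 * n) i ∈ UkSub q n := by
  by_cases hi : 1 ≤ i ∧ i ≤ 2 * n
  · exact Algebra.subset_adjoin (.inl ⟨i, hi.1, hi.2, .inl rfl⟩)
  · have : uK q (2 * n) i = 1 := (RingQuot.mkAlgHom_rel ℂ (Rel.Kout i hi)).trans (map_one _)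
    exact this ▸ one_mem _

theorem uKi_mem (i : ℕ) : uKi q (2 * n) i ∈ UkSub q n := by
  by_cases hi : 1 ≤ i ∧ i ≤ 2 * n
  · exact Algebra.subset_adjoin (.inl ⟨i, hi.1, hi.2, .inr rfl⟩)
  · have : uKi q (2 * n) i = 1 := (RingQuot.mkAlgHom_rel ℂ (Rel.Kiout i hi)).trans (map_one _)
    exact this ▸ one_mem _

theorem uE_mem {j : ℕ} (hj : j ≠ n) : uE q (2 * n) j ∈ UkSub q n := by
  by_cases hj' : 1 ≤ j ∧ j + 1 ≤ 2 * n
  · exact Algebra.subset_adjoin (.inr ⟨j, hj'.1, hj'.2, hj, .inl rfl⟩)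
  · have : uE q (2 * n) j = 0 := (RingQuot.mkAlgHom_rel ℂ (Rel.Eout j hj')).trans (map_zero _)
    exact this ▸ zero_mem _

theorem uF_mem {j : ℕ} (hj : j ≠ n) : uF q (2 * n) j ∈ UkSub q n := by
  by_cases hj' : 1 ≤ j ∧ j + 1 ≤ 2 * n
  · exact Algebra.subset_adjoin (.inr ⟨j, hj'.1, hj'.2, hj, .inr rfl⟩)
  · have : uF q (2 * n) j = 0 := (RingQuot.mkAlgHom_rel ℂ (Rel.Fout j hj')).trans (map_zero _)
    exact this ▸ zero_mem _

theorem ukClass_eq_zero_of_IRel {x : Uq q (2 * n)} (hx : x ∈ UkSub q n)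
    (h : x = uE q (2 * n) (n - 1) * uF q (2 * n) (n + 1) ∨
      x = uE q (2 * n) (n + 1) * uF q (2 * n) (n - 1)) : ukClass q n x = 0 := by
  lift x to ↥(UkSub q n) using hx
  rw [ukClass_coe]
  exact (RingQuot.mkAlgHom_rel ℂ (show IRel q n x 0 from ⟨rfl, h⟩)).trans (map_zero _)

/-- The classes of the generators of `U_q(k)` in `U_q(k)/I` form a `LeviSystem`. -/
theorem leviSystem_ukClass (hn : 2 ≤ n) :
    LeviSystem (q : ℂ) n (fun i => ukClass q n (uK q (2 * n) i))
      (fun i => ukClass q n (uKi q (2 * n) i)) (fun j => ukClass q n (uE q (2 * n) j))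
      (fun j => ukClass q n (uF q (2 * n) j)) := by
  have rel {x y : FA} (h : Rel q (2 * n) x y) :
      ukClass q n (RingQuot.mkAlgHom ℂ (Rel q (2 * n)) x) =
        ukClass q n (RingQuot.mkAlgHom ℂ (Rel q (2 * n)) y) :=
    congrArg _ (RingQuot.mkAlgHom_rel ℂ h)
  have serre (c : ℂ) {x y : Uq q (2 * n)} (hx : x ∈ UkSub q n) (hy : y ∈ UkSub q n)
      (hxy : ukClass q n (x ^ 2 * y - c • (x * y * x) + y * x ^ 2) = ukClass q n 0) :
      ukClass q n x ^ 2 * ukClass q n y - c • (ukClass q n x * ukClass q n y * ukClass q n x) +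
        ukClass q n y * ukClass q n x ^ 2 = 0 := by
    rw [pow_two x] at hxy
    have hxx := mul_mem hx hx
    have hxyx := mul_mem (mul_mem hx hy) hx
    rwa [ukClass_add (sub_mem (mul_mem hxx hy) (Subalgebra.smul_mem _ hxyx c)) (mul_mem hy hxx),
      ukClass_sub (mul_mem hxx hy) (Subalgebra.smul_mem _ hxyx c), ukClass_smul c hxyx,
      ukClass_mul hxx hy, ukClass_mul (mul_mem hx hy) hx, ukClass_mul hx hy, ukClass_mul hy hxx,
      ukClass_mul hx hx, ukClass_zero, ← pow_two] at hxy
  have bracket {x y : Uq q (2 * n)} (hx : x ∈ UkSub q n) (hy : y ∈ UkSub q n) :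
      ukClass q n (x * y - y * x) =
        ukClass q n x * ukClass q n y - ukClass q n y * ukClass q n x := by
    rw [ukClass_sub (mul_mem hx hy) (mul_mem hy hx), ukClass_mul hx hy, ukClass_mul hy hx]
  constructor
  case k_out => exact fun i hi => (rel (Rel.Kout i hi)).trans (by rw [map_one, ukClass_one])
  case ki_out => exact fun i hi => (rel (Rel.Kiout i hi)).trans (by rw [map_one, ukClass_one])
  case e_out => exact fun j hj => (rel (Rel.Eout j hj)).trans (by rw [map_zero, ukClass_zero])
  case f_out => exact fun j hj => (rel (Rel.Fout j hj)).trans (by rw [map_zero, ukClass_zero])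
  case k_k =>
    intro i j
    have := rel (Rel.KK (q := q) (m := 2 * n) i j)
    rw [map_mul, map_mul] at this
    rw [← ukClass_mul (uK_mem i) (uK_mem j), ← ukClass_mul (uK_mem j) (uK_mem i)]
    exact this
  case k_ki =>
    intro i
    have := rel (Rel.KKi (q := q) (m := 2 * n) i)
    rw [map_mul, map_one, ukClass_one] at this
    rw [← ukClass_mul (uK_mem i) (uKi_mem i)]
    exact this
  case ki_k =>
    intro i
    have := rel (Rel.KiK (q := q) (m := 2 * n) i)
    rw [map_mul, map_one, ukClass_one] at this
    rw [← ukClass_mul (uKi_mem i) (uK_mem i)]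
    exact this
  case k_e =>
    intro i j hi hi' hj hj' hjn
    have := rel (Rel.KE (q := q) i j hi hi' hj hj')
    rw [map_mul, map_smul, map_mul] at this
    rw [← ukClass_mul (uK_mem i) (uE_mem hjn), ← ukClass_mul (uE_mem hjn) (uK_mem i),
      ← ukClass_smul _ (mul_mem (uE_mem hjn) (uK_mem i))]
    exact this
  case k_f =>
    intro i j hi hi' hj hj' hjn
    have := rel (Rel.KF (q := q) i j hi hi' hj hj')
    rw [map_mul, map_smul, map_mul] at this
    rw [rootPairing, neg_sub, ← ukClass_mul (uK_mem i) (uF_mem hjn),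
      ← ukClass_mul (uF_mem hjn) (uK_mem i), ← ukClass_smul _ (mul_mem (uF_mem hjn) (uK_mem i))]
    exact this
  case e_f =>
    intro i hi hi' hin
    have := rel (Rel.EF (q := q) i i hi hi' hi hi')
    rw [if_pos rfl] at this
    simp only [map_sub, map_mul, map_smul] at this
    rw [← bracket (uE_mem hin) (uF_mem hin), ← ukClass_mul (uK_mem _) (uKi_mem _),
      ← ukClass_mul (uKi_mem _) (uK_mem _),
      ← ukClass_sub (mul_mem (uK_mem _) (uKi_mem _)) (mul_mem (uKi_mem _) (uK_mem _)),
      ← ukClass_smul _ (sub_mem (mul_mem (uK_mem _) (uKi_mem _)) (mul_mem (uKi_mem _) (uK_mem _)))]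
    exact this
  case e_f_comm =>
    intro i j hi hi' hin hj hj' hjn hij
    have := rel (Rel.EF (q := q) i j hi hi' hj hj')
    rw [if_neg hij] at this
    simp only [map_sub, map_mul, map_zero, ukClass_zero] at this
    rw [← sub_eq_zero, ← bracket (uE_mem hin) (uF_mem hjn)]
    exact this
  case e_e =>
    intro i j hi hi' hin hj hj' hjn hij
    have := rel (Rel.EE (q := q) i j hi hi' hj hj' hij)
    rw [map_mul, map_mul] at this
    rw [← ukClass_mul (uE_mem hin) (uE_mem hjn), ← ukClass_mul (uE_mem hjn) (uE_mem hin)]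
    exact this
  case f_f =>
    intro i j hi hi' hin hj hj' hjn hij
    have := rel (Rel.FF (q := q) i j hi hi' hj hj' hij)
    rw [map_mul, map_mul] at this
    rw [← ukClass_mul (uF_mem hin) (uF_mem hjn), ← ukClass_mul (uF_mem hjn) (uF_mem hin)]
    exact this
  case e_serre =>
    intro i j hi hi' hin hj hj' hjn hij
    have := rel (Rel.Eserre (q := q) i j hi hi' hj hj' hij)
    simp only [map_sub, map_add, map_mul, map_smul, map_pow, map_zero] at this
    exact serre _ (uE_mem hin) (uE_mem hjn) this
  case f_serre =>
    intro i j hi hi' hin hj hj' hjn hij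
    have := rel (Rel.Fserre (q := q) i j hi hi' hj hj' hij)
    simp only [map_sub, map_add, map_mul, map_smul, map_pow, map_zero] at this
    exact serre _ (uF_mem hin) (uF_mem hjn) this
  case e_f_pred =>
    have hE : uE q (2 * n) (n - 1) ∈ UkSub q n := uE_mem (by omega)
    have hF : uF q (2 * n) (n + 1) ∈ UkSub q n := uF_mem (by omega)
    rw [← ukClass_mul hE hF]
    exact ukClass_eq_zero_of_IRel (mul_mem hE hF) (.inl rfl)
  case e_f_succ =>
    have hE : uE q (2 * n) (n + 1) ∈ UkSub q n := uE_mem (by omega)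
    have hF : uF q (2 * n) (n - 1) ∈ UkSub q n := uF_mem (by omega)
    rw [← ukClass_mul hE hF]
    exact ukClass_eq_zero_of_IRel (mul_mem hE hF) (.inr rfl)

end Quotient

end QG

open QG in
/-- For every `σ ∈ ℝ` the assignment `γ_i^{±1} ↦ C_i^{±1} + I`, `β_j ↦ B_j + I`
(`j ≠ n`), `β_n ↦ B̂_n^σ + I` extends to an algebra homomorphism
`φ_σ : 𝒜 → U_q(k)/I`.  (The images are specified through arbitrary
representatives `z ∈ U_q(k)` of the elements `C_i^{±1}`, `B_j`, `B̂_n^σ`.) -/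
theorem statement_7 (q : ℝ) (hq0 : 0 < q) (hq1 : q < 1) (n : ℕ) (hn : 2 ≤ n) (σ : ℝ) :
    ∃ φ : Aalg q n →ₐ[ℂ] UkQ q n,
      (∀ i, 1 ≤ i → i ≤ 2*n → ∀ z : ↥(UkSub q n),
        (z : Uq q (2*n)) = Cc q n i → φ (aγ q n i) = ukmk q n z) ∧
      (∀ i, 1 ≤ i → i ≤ 2*n → ∀ z : ↥(UkSub q n),
        (z : Uq q (2*n)) = Ccinv q n i → φ (aγi q n i) = ukmk q n z) ∧
      (∀ j, 1 ≤ j → j + 1 ≤ 2*n → j ≠ n → ∀ z : ↥(UkSub q n),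
        (z : Uq q (2*n)) = Bb q n j → φ (aβ q n j) = ukmk q n z) ∧
      (∀ z : ↥(UkSub q n),
        (z : Uq q (2*n)) = Bhat q σ n → φ (aβ q n n) = ukmk q n z) := by
  have hq : (q : ℂ) ≠ 0 := by exact_mod_cast hq0.ne'
  have hqq : (q : ℂ) - (q : ℂ)⁻¹ ≠ 0 := by
    have : q - q⁻¹ ≠ 0 := (sub_neg.mpr (hq1.trans ((one_lt_inv₀ hq0).mpr hq1))).ne
    exact_mod_cast this
  have hst : ((q ^ (-σ) : ℝ) : ℂ) * ((q ^ σ : ℝ) : ℂ) = 1 := by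
    rw [← Complex.ofReal_mul, ← Real.rpow_add hq0, neg_add_cancel, Real.rpow_zero,
      Complex.ofReal_one]
  have h := leviSystem_ukClass (q := q) hn
  let φ : Aalg q n →ₐ[ℂ] UkQ q n :=
    RingQuot.liftAlgHom ℂ ⟨_, h.genImage_rel hq hqq hn hst⟩
  refine ⟨φ, fun i _ _ z hz => ?_, fun i _ _ z hz => ?_, fun j hj hj' hjn z hz => ?_,
    fun z hz => ?_⟩
  · rw [← ukClass_coe, hz, Cc, ukClass_mul (uK_mem _) (uK_mem _)]
    simp [φ, aγ, fγ, genImage]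
  · rw [← ukClass_coe, hz, Ccinv, ukClass_mul (uKi_mem _) (uKi_mem _)]
    simp [φ, aγi, fγi, genImage]
  · have hE : uE q (2 * n) (2 * n - j) ∈ UkSub q n := uE_mem (by omega)
    have hF : uF q (2 * n) j ∈ UkSub q n := uF_mem hjn
    rw [← ukClass_coe, hz, Bb,
      ukClass_add (mul_mem (mul_mem hF (uKi_mem _)) (uKi_mem _))
        (mul_mem (mul_mem (uKi_mem _) hE) (uKi_mem _)),
      ukClass_mul (mul_mem hF (uKi_mem _)) (uKi_mem _), ukClass_mul hF (uKi_mem _),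
      ukClass_mul (mul_mem (uKi_mem _) hE) (uKi_mem _), ukClass_mul (uKi_mem _) hE,
      h.bUpper_eq hq hj hj' hjn, mul_assoc]
    simp [φ, aβ, fβ, genImage, bGen, hjn, bLower]
  · have hsq (i : ℕ) : uKi q (2 * n) i ^ 2 ∈ UkSub q n := pow_mem (uKi_mem i) 2
    have hsq' (i : ℕ) : ukClass q n (uKi q (2 * n) i ^ 2) = ukClass q n (uKi q (2 * n) i) ^ 2 := by
      rw [pow_two, pow_two, ukClass_mul (uKi_mem i) (uKi_mem i)]
    rw [← ukClass_coe, hz, Bhat,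
      ukClass_smul _ (sub_mem (Subalgebra.smul_mem _ (hsq _) _) (Subalgebra.smul_mem _ (hsq _) _)),
      ukClass_sub (Subalgebra.smul_mem _ (hsq _) _) (Subalgebra.smul_mem _ (hsq _) _),
      ukClass_smul _ (hsq _), ukClass_smul _ (hsq _), hsq', hsq']
    simp [φ, aβ, fβ, genImage, bGen, bMiddle]
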